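/- arXiv:2501.02691 — 3 statements merged into one kernel-verified Lean document; each statement's English description precedes it below -/
import Mathlib

section
/- Let τ_c ∈ 𝕊, and for each m ∈ {0,…,d} let σ_m ∈ 𝕊 and let c^m : ({0,…,d}\{m}) × ({0,…,d}\{m}) → R be skew-symmetric (c^m_{ij} = −c^m_{ji}). Suppose that for every i ∈ {0,…,d} and every x ∈ T_i: μ^{(i)}_c(x)·τ_c + Σ_{m≠i} μ^{(i)}_m(x)·( σ_m + 2·Σ_{j∉{m,i}} c^m_{ij}·sym(t_{m,c} ⊗ t_{m,j}) ) = 0. Then τ_c = 0 and, for every m, σ_m = 0 and c^m ≡ 0. (Geometric decomposition: the sum λ^R_c·P_0(T;𝕊) ⊕ ⨁_{m=0}^{d} ( λ^R_m·P_0(T;𝕊) ⊕ λ^R_m·Φ^m(𝕊) ) defining Σ^{div}_{1,φ}(T^R;𝕊) is direct; in particular dim Σ^{div}_{1,φ}(T^R;𝕊) = d(d+1)(2d+1)/2.) -/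
open Matrix Finset

/-- `sym(a ⊗ b) = (a bᵀ + b aᵀ)/2`, the symmetric part of the rank-one matrix `a bᵀ`. -/
noncomputable def symOuter {d : ℕ} (a b : Fin d → ℝ) : Matrix (Fin d) (Fin d) ℝ :=
  (1 / 2 : ℝ) • (Matrix.vecMulVec a b + Matrix.vecMulVec b a)

/-- The edge vectors of a simplex emanating from one vertex are linearly independent. -/
theorem AffineIndependent.eq_zero_of_sum_smul_sub_eq_zero {ι V : Type*} [Fintype ι]
    [AddCommGroup V] [Module ℝ V] {v : ι → V} (hv : AffineIndependent ℝ v) (m : ι) (w : ι → ℝ)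
    (h : ∑ j, w j • (v j - v m) = 0) {j : ι} (hj : j ≠ m) : w j = 0 := by
  classical
  have hlin := (affineIndependent_iff_linearIndependent_vsub ℝ v m).1 hv
  rw [Fintype.linearIndependent_iff] at hlin
  refine hlin (fun k => w k) ?_ ⟨j, hj⟩
  rw [← h, ← Fintype.sum_subtype_add_sum_subtype (fun x => x ≠ m)]
  have hzero : ∑ k : {x // ¬ x ≠ m}, w k • (v k - v m) = 0 :=
    Finset.sum_eq_zero fun k _ => by rw [not_not.1 k.2, sub_self, smul_zero]
  rw [hzero, add_zero]
  rfl

/-- The vector from a vertex of a nondegenerate simplex to its barycenter is nonzero. -/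
theorem barycenter_sub_ne_zero {d : ℕ} (hd : 2 ≤ d) {v : Fin (d + 1) → (Fin d → ℝ)}
    (hv : AffineIndependent ℝ v) (m : Fin (d + 1)) :
    ((d : ℝ) + 1)⁻¹ • ∑ k, v k - v m ≠ 0 := by
  intro h
  have : Nontrivial (Fin (d + 1)) := Fin.nontrivial_iff_two_le.2 (by omega)
  obtain ⟨j, hj⟩ := exists_ne m
  have hd0 : (d : ℝ) + 1 ≠ 0 := by positivity
  refine one_ne_zero (hv.eq_zero_of_sum_smul_sub_eq_zero m (fun _ => 1) ?_ hj)
  have hsum : ∑ k, v k = ((d : ℝ) + 1) • v m := by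
    rw [← sub_eq_zero.1 h, smul_inv_smul₀ hd0]
  simp only [one_smul, Finset.sum_sub_distrib, hsum, Finset.sum_const, Finset.card_univ,
    Fintype.card_fin]
  rw [← Nat.cast_smul_eq_nsmul ℝ]
  push_cast
  exact sub_self _

theorem symOuter_sum_smul {d : ℕ} {ι : Type*} (s : Finset ι) (a : Fin d → ℝ) (w : ι → ℝ)
    (b : ι → Fin d → ℝ) :
    symOuter a (∑ j ∈ s, w j • b j) = ∑ j ∈ s, w j • symOuter a (b j) := by
  ext p q
  simp only [symOuter, Matrix.smul_apply, Matrix.add_apply, Matrix.vecMulVec_apply,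
    Matrix.sum_apply, Finset.sum_apply, Pi.smul_apply, smul_eq_mul, Finset.mul_sum,
    Finset.sum_mul, ← Finset.sum_add_distrib]
  exact Finset.sum_congr rfl fun _ _ => by ring

/-- For `a ≠ 0` the linear map `b ↦ sym(a ⊗ b)` is injective. -/
theorem symOuter_injective {d : ℕ} {a : Fin d → ℝ} (ha : a ≠ 0) :
    Function.Injective (symOuter a) := by
  intro b b' h
  obtain ⟨p, hp⟩ := Function.ne_iff.1 ha
  have hp0 : a p ≠ 0 := hp
  have entry (q : Fin d) : a p * b q + b p * a q = a p * b' q + b' p * a q := by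
    have := congrFun (congrFun h p) q
    simp only [symOuter, Matrix.smul_apply, Matrix.add_apply, Matrix.vecMulVec_apply,
      smul_eq_mul] at this
    linarith
  have hbp : b p = b' p := mul_left_cancel₀ hp0 (by linarith [entry p])
  ext q
  have := entry q
  rw [hbp] at this
  exact mul_left_cancel₀ hp0 (by linarith)

/-- geometric decomposition of the linear element. If the piecewise-linear
symmetric field `λ^R_c τ_c + ∑_m λ^R_m (σ_m + 2 ∑_{j∉{m,i}} c^m_{ij} sym(t_{m,c} ⊗ t_{m,j}))`
vanishes identically on every cell `T_i` of the barycentric split, then `τ_c = 0` and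
`σ_m = 0`, `c^m ≡ 0` for every `m`; i.e. the sum defining `Σ^{div}_{1,φ}(T^R;𝕊)` is direct.
Here `μ^{(i)}_m, μ^{(i)}_c` are the barycentric coordinates of the affine basis
`{v_m : m ≠ i} ∪ {v_c}`, with `μ^{(i)}_i := 0`. -/
theorem statement8 (d : ℕ) (hd : 2 ≤ d)
    (v : Fin (d + 1) → (Fin d → ℝ)) (hv : AffineIndependent ℝ v)
    (vc : Fin d → ℝ) (hvc : vc = ((d : ℝ) + 1)⁻¹ • ∑ k, v k)
    -- barycentric coordinates of the affine bases {v m : m ≠ i} ∪ {v_c}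
    (μ : Fin (d + 1) → Fin (d + 1) → (Fin d → ℝ) → ℝ)
    (μc : Fin (d + 1) → (Fin d → ℝ) → ℝ)
    (hμaff : ∀ i m, ∃ q : (Fin d → ℝ) →ᵃ[ℝ] ℝ, ∀ x, μ i m x = q x)
    (hμcaff : ∀ i, ∃ q : (Fin d → ℝ) →ᵃ[ℝ] ℝ, ∀ x, μc i x = q x)
    (hμself : ∀ i x, μ i i x = 0)
    (hμsum : ∀ i x, μc i x + ∑ m, μ i m x = 1)
    (hμval : ∀ i m m' : Fin (d + 1), m ≠ i → m' ≠ i →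
      μ i m (v m') = if m = m' then 1 else 0)
    (hμvc : ∀ i m : Fin (d + 1), m ≠ i → μ i m vc = 0)
    (hμcval : ∀ i m' : Fin (d + 1), m' ≠ i → μc i (v m') = 0)
    (hμcvc : ∀ i, μc i vc = 1)
    -- the data of an element of Σ^{div}_{1,φ}(T^R; 𝕊)
    (τc : Matrix (Fin d) (Fin d) ℝ) (hτc : τc.IsSymm)
    (σ : Fin (d + 1) → Matrix (Fin d) (Fin d) ℝ) (hσ : ∀ m, (σ m).IsSymm)
    (c : Fin (d + 1) → Fin (d + 1) → Fin (d + 1) → ℝ)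
    (hcskew : ∀ m a b : Fin (d + 1), a ≠ m → b ≠ m → c m a b = - c m b a)
    -- the field vanishes on every cell T_i of the split
    (heq : ∀ i : Fin (d + 1),
      ∀ x ∈ convexHull ℝ ((v '' {m | m ≠ i}) ∪ {vc}),
        μc i x • τc +
          ∑ m ∈ Finset.univ.filter (fun m : Fin (d + 1) => m ≠ i),
            μ i m x • (σ m + (2 : ℝ) •
              ∑ j ∈ Finset.univ.filter (fun j : Fin (d + 1) => j ≠ m ∧ j ≠ i),
                c m i j • symOuter (vc - v m) (v j - v m)) = 0) :
    τc = 0 ∧ ∀ m : Fin (d + 1),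
      σ m = 0 ∧ ∀ a b : Fin (d + 1), a ≠ m → b ≠ m → c m a b = 0 := by
  have hcenter (i : Fin (d + 1)) : vc ∈ convexHull ℝ ((v '' {m | m ≠ i}) ∪ {vc}) :=
    subset_convexHull ℝ _ (Or.inr rfl)
  have hvertex {i m : Fin (d + 1)} (h : m ≠ i) :
      v m ∈ convexHull ℝ ((v '' {m | m ≠ i}) ∪ {vc}) :=
    subset_convexHull ℝ _ (Or.inl ⟨m, h, rfl⟩)
  refine ⟨?_, fun m => ?_⟩
  · have h := heq 0 vc (hcenter 0)
    rw [hμcvc, one_smul, Finset.sum_eq_zero, add_zero] at h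
    · exact h
    · intro m hm
      rw [hμvc 0 m (Finset.mem_filter.1 hm).2, zero_smul]
  have hcdiag (a : Fin (d + 1)) (ha : a ≠ m) : c m a a = 0 := by
    linarith [hcskew m a a ha ha]
  have hedge : vc - v m ≠ 0 := hvc ▸ barycenter_sub_ne_zero hd hv m
  -- the trace of the field on the cell `T_i` at the vertex `v m`
  have htrace (i : Fin (d + 1)) (hi : i ≠ m) :
      σ m + (2 : ℝ) • symOuter (vc - v m) (∑ j, c m i j • (v j - v m)) = 0 := by
    have h := heq i (v m) (hvertex hi.symm)
    rw [hμcval i m hi.symm, zero_smul, zero_add,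
      Finset.sum_eq_single_of_mem m (by simpa using hi.symm), hμval i m m hi.symm hi.symm,
      if_pos rfl, one_smul, ← symOuter_sum_smul, Finset.sum_filter_of_ne] at h
    · exact h
    · intro j _ hj
      constructor
      · rintro rfl
        simp at hj
      · rintro rfl
        simp [hcdiag j hi] at hj
    · intro k hk hkm
      rw [hμval i k m (Finset.mem_filter.1 hk).2 hi.symm, if_neg hkm, zero_smul]
  have hczero (a b : Fin (d + 1)) (ha : a ≠ m) (hb : b ≠ m) : c m a b = 0 := by
    have hsym := add_left_cancel ((htrace a ha).trans (htrace b hb).symm)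
    have hvec := symOuter_injective hedge (smul_right_injective _ (two_ne_zero (α := ℝ)) hsym)
    have hdiff := hv.eq_zero_of_sum_smul_sub_eq_zero m (fun j => c m a j - c m b j)
      (by simp only [sub_smul, Finset.sum_sub_distrib]; exact sub_eq_zero.2 hvec) hb
    linarith [hcdiag b hb]
  refine ⟨?_, hczero⟩
  have : Nontrivial (Fin (d + 1)) := Fin.nontrivial_iff_two_le.2 (by omega)
  obtain ⟨i, hi⟩ := exists_ne m
  have h := htrace i hi
  rw [Finset.sum_eq_zero] at h
  · simpa [symOuter] using h
  · intro j _
    by_cases hj : j = m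
    · rw [hj, sub_self, smul_zero]
    · rw [hczero i j hi hj, zero_smul]
end

section
/- Let τ_c ∈ 𝕊, and for each m ∈ {0,…,d} let σ_m ∈ 𝕊 and let c^m : ({0,…,d}\{m}) × ({0,…,d}\{m}) → R be skew-symmetric; these data parametrize an element of Σ^{div}_{1,φ}(T^R;𝕊) whose value at the barycenter v_c is τ_c and whose value at the vertex v_m seen from the cell T_p (p ≠ m) is σ_m + 2·Σ_{j∉{m,p}} c^m_{pj}·sym(t_{m,c} ⊗ t_{m,j}). For each p ∈ {0,…,d}, let N_p be a nonzero vector orthogonal to v_a − v_b for all a, b ∈ {0,…,d}\{p} (a normal of the facet of T opposite v_p). Assume all degrees of freedom vanish: τ_c = 0, and for every m and every p ≠ m, ( σ_m + 2·Σ_{j∉{m,p}} c^m_{pj}·sym(t_{m,c} ⊗ t_{m,j}) )·N_p = 0. Then σ_m = 0 and c^m ≡ 0 for every m. (Unisolvence of the degrees of freedom { τ n_F(v) : v a vertex of T, F a facet of T containing v } ∪ { τ(v_c) } for the linear element Σ^{div}_{1,φ}(T^R;𝕊).) -/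
open Matrix Finset

lemma symOuter_mulVec {d : ℕ} (a b x : Fin d → ℝ) :
    symOuter a b *ᵥ x = (1 / 2 : ℝ) • ((b ⬝ᵥ x) • a + (a ⬝ᵥ x) • b) := by
  simp [symOuter, smul_mulVec, add_mulVec, vecMulVec_mulVec]

/-- The edge vectors of a `d`-simplex in `ℝ^d` emanating from one vertex form a basis. -/
lemma AffineIndependent.exists_basis_sub {d : ℕ} {v : Fin (d + 1) → (Fin d → ℝ)}
    (hv : AffineIndependent ℝ v) (m : Fin (d + 1)) :
    ∃ B : Module.Basis {i : Fin (d + 1) // i ≠ m} ℝ (Fin d → ℝ), ∀ i, B i = v i - v m := by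
  have hli := (affineIndependent_iff_linearIndependent_vsub ℝ v m).mp hv
  have hcard : Fintype.card {i : Fin (d + 1) // i ≠ m} = Module.finrank ℝ (Fin d → ℝ) := by
    simp [Fintype.card_subtype_compl]
  refine ⟨Module.Basis.mk hli (hli.span_eq_top_of_card_eq_finrank' hcard).ge, fun i => ?_⟩
  simp

/-- Orthogonality to the facet opposite `v p` gives a biorthogonality relation between the edges
at `v m` and the normals of the facets containing `v m`; the diagonal pairing is nonzero. -/
lemma AffineIndependent.sub_dotProduct_normal_ne_zero {d : ℕ} {v : Fin (d + 1) → (Fin d → ℝ)}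
    (hv : AffineIndependent ℝ v) {m p : Fin (d + 1)} (hpm : p ≠ m) {n : Fin d → ℝ} (hn : n ≠ 0)
    (horth : ∀ a b : Fin (d + 1), a ≠ p → b ≠ p → (v a - v b) ⬝ᵥ n = 0) :
    (v p - v m) ⬝ᵥ n ≠ 0 := by
  intro h0
  obtain ⟨B, hB⟩ := hv.exists_basis_sub m
  refine hn (dotProduct_self_eq_zero.mp ?_)
  have hedge : ∀ i, B i ⬝ᵥ n = 0 := fun i => by
    rw [hB]
    by_cases hi : (i : Fin (d + 1)) = p
    · rwa [hi]
    · exact horth _ _ hi hpm.symm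
  conv_lhs => arg 1; rw [← B.sum_repr n]
  rw [sum_dotProduct]
  exact Finset.sum_eq_zero fun i _ => by rw [smul_dotProduct, hedge, smul_zero]

/-- A vector orthogonal to the normals of all facets through `v m` vanishes. -/
lemma AffineIndependent.eq_zero_of_dotProduct_normal {d : ℕ} {v : Fin (d + 1) → (Fin d → ℝ)}
    (hv : AffineIndependent ℝ v) {N : Fin (d + 1) → (Fin d → ℝ)} (hN0 : ∀ p, N p ≠ 0)
    (hNorth : ∀ p a b : Fin (d + 1), a ≠ p → b ≠ p → (v a - v b) ⬝ᵥ N p = 0)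
    (m : Fin (d + 1)) {x : Fin d → ℝ} (hx : ∀ p, p ≠ m → x ⬝ᵥ N p = 0) : x = 0 := by
  obtain ⟨B, hB⟩ := hv.exists_basis_sub m
  rw [← B.forall_coord_eq_zero_iff]
  rintro ⟨p, hp⟩
  have h := hx p hp
  rw [← B.sum_repr x, sum_dotProduct, Finset.sum_eq_single ⟨p, hp⟩] at h
  · rw [smul_dotProduct, hB, smul_eq_mul] at h
    exact (mul_eq_zero.mp h).resolve_right
      (hv.sub_dotProduct_normal_ne_zero hp (hN0 p) (hNorth p))
  · intro i _ hi
    rw [smul_dotProduct, hB, hNorth p _ _ (fun h => hi (Subtype.ext h)) hp.symm, smul_zero]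
  · simp

/-- The barycenter sees the facet normal `n` opposite `v p` with a fixed fraction of the weight
of `v p`. -/
lemma barycenter_sub_dotProduct_normal {d : ℕ} (v : Fin (d + 1) → (Fin d → ℝ))
    {m p : Fin (d + 1)} (hpm : p ≠ m) {n : Fin d → ℝ}
    (horth : ∀ a b : Fin (d + 1), a ≠ p → b ≠ p → (v a - v b) ⬝ᵥ n = 0) :
    (((d : ℝ) + 1)⁻¹ • ∑ k, v k - v m) ⬝ᵥ n = ((d : ℝ) + 1)⁻¹ * ((v p - v m) ⬝ᵥ n) := by
  have hd : (d : ℝ) + 1 ≠ 0 := by positivity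
  have hsum : ((d : ℝ) + 1)⁻¹ • ∑ k, v k - v m = ((d : ℝ) + 1)⁻¹ • ∑ k, (v k - v m) := by
    rw [Finset.sum_sub_distrib, smul_sub, Finset.sum_const, Finset.card_univ, Fintype.card_fin,
      ← Nat.cast_smul_eq_nsmul ℝ, smul_smul, Nat.cast_add, Nat.cast_one, inv_mul_cancel₀ hd,
      one_smul]
  rw [hsum, smul_dotProduct, sum_dotProduct, smul_eq_mul,
    Finset.sum_eq_single p (fun k _ hk => horth k m hk hpm.symm) (by simp)]

/-- unisolvence of the DoFs for the linear element `Σ^{div}_{1,φ}(T^R;𝕊)`.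
If the DoFs all vanish — the value `τ_c` at the barycenter is zero, and for every vertex
`v_m` and every facet normal `N_p` (`p ≠ m`) the normal trace of the value at `v_m` seen
from the cell `T_p`, namely `(σ_m + 2 ∑_{j∉{m,p}} c^m_{pj} sym(t_{m,c} ⊗ t_{m,j})) N_p`,
vanishes — then `σ_m = 0` and `c^m ≡ 0` for every `m`. -/
theorem statement9 (d : ℕ) (hd : 2 ≤ d)
    (v : Fin (d + 1) → (Fin d → ℝ)) (hv : AffineIndependent ℝ v)
    (vc : Fin d → ℝ) (hvc : vc = ((d : ℝ) + 1)⁻¹ • ∑ k, v k)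
    (τc : Matrix (Fin d) (Fin d) ℝ) (hτc : τc.IsSymm)
    (σ : Fin (d + 1) → Matrix (Fin d) (Fin d) ℝ) (hσ : ∀ m, (σ m).IsSymm)
    (c : Fin (d + 1) → Fin (d + 1) → Fin (d + 1) → ℝ)
    (hcskew : ∀ m a b : Fin (d + 1), a ≠ m → b ≠ m → c m a b = - c m b a)
    (N : Fin (d + 1) → (Fin d → ℝ))
    (hN0 : ∀ p, N p ≠ 0)
    (hNorth : ∀ p a b : Fin (d + 1), a ≠ p → b ≠ p → (v a - v b) ⬝ᵥ N p = 0)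
    (hτc0 : τc = 0)
    (hdof : ∀ m p : Fin (d + 1), p ≠ m →
      (σ m + (2 : ℝ) •
        ∑ j ∈ Finset.univ.filter (fun j : Fin (d + 1) => j ≠ m ∧ j ≠ p),
          c m p j • symOuter (vc - v m) (v j - v m)) *ᵥ N p = 0) :
    ∀ m : Fin (d + 1),
      σ m = 0 ∧ ∀ a b : Fin (d + 1), a ≠ m → b ≠ m → c m a b = 0 := by
  intro m
  have hnormal : ∀ p, p ≠ m → σ m *ᵥ N p =
      -((((d : ℝ) + 1)⁻¹ * ((v p - v m) ⬝ᵥ N p)) •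
        ∑ j ∈ Finset.univ.filter (fun j : Fin (d + 1) => j ≠ m ∧ j ≠ p),
          c m p j • (v j - v m)) := by
    intro p hp
    rw [eq_neg_iff_add_eq_zero, ← hdof m p hp, add_mulVec, smul_mulVec, sum_mulVec,
      Finset.smul_sum, Finset.smul_sum]
    congr 1
    refine Finset.sum_congr rfl fun j hj => ?_
    obtain ⟨-, hjp⟩ := (Finset.mem_filter.mp hj).2
    rw [smul_mulVec, symOuter_mulVec, hNorth p j m hjp hp.symm, hvc,
      barycenter_sub_dotProduct_normal v hp (hNorth p), zero_smul, zero_add]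
    simp only [smul_smul]
    congr 1
    ring
  have hpair : ∀ p q, p ≠ m → q ≠ m → q ≠ p → N q ⬝ᵥ (σ m *ᵥ N p) =
      -(((d : ℝ) + 1)⁻¹ * ((v p - v m) ⬝ᵥ N p) * ((v q - v m) ⬝ᵥ N q) * c m p q) := by
    intro p q hp hq hqp
    rw [hnormal p hp, dotProduct_comm, neg_dotProduct, smul_dotProduct, sum_dotProduct,
      Finset.sum_eq_single q]
    · simp only [smul_dotProduct, smul_eq_mul]
      ring
    · intro j _ hjq
      rw [smul_dotProduct, hNorth q j m hjq hq.symm, smul_zero]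
    · simp [hq, hqp]
  have hc : ∀ a b : Fin (d + 1), a ≠ m → b ≠ m → c m a b = 0 := by
    intro a b ha hb
    have hskew := hcskew m a b ha hb
    rcases eq_or_ne b a with rfl | hba
    · linarith
    have hsymm : N b ⬝ᵥ (σ m *ᵥ N a) = N a ⬝ᵥ (σ m *ᵥ N b) := by
      rw [dotProduct_mulVec, ← mulVec_transpose, (hσ m).eq, dotProduct_comm]
    rw [hpair a b ha hb hba, hpair b a hb ha hba.symm, hskew] at hsymm
    have hprod : ((d : ℝ) + 1)⁻¹ * ((v a - v m) ⬝ᵥ N a) * ((v b - v m) ⬝ᵥ N b) ≠ 0 :=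
      mul_ne_zero (mul_ne_zero (by positivity)
        (hv.sub_dotProduct_normal_ne_zero ha (hN0 a) (hNorth a)))
        (hv.sub_dotProduct_normal_ne_zero hb (hN0 b) (hNorth b))
    have hzero : c m b a = 0 := by
      refine (mul_eq_zero.mp ?_).resolve_left hprod
      linear_combination hsymm / 2
    rw [hskew, hzero, neg_zero]
  refine ⟨?_, hc⟩
  funext r
  refine hv.eq_zero_of_dotProduct_normal hN0 hNorth m fun p hp => ?_
  have h : σ m *ᵥ N p = 0 := by
    rw [hnormal p hp, Finset.sum_eq_zero, smul_zero, neg_zero]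
    intro j hj
    rw [hc p j hp (Finset.mem_filter.mp hj).2.1, zero_smul]
  exact congrFun h r
end

section
/- Let τ_0,…,τ_d : R^d → 𝕊 be maps each of whose matrix entries is an affine function of x. For each 0 ≤ i < j ≤ d, let n_{ij} be a nonzero vector orthogonal to v_ℓ − v_c for all ℓ ∈ {0,…,d}\{i,j}, and assume that for every x ∈ F_{ij}: (τ_i(x) − τ_j(x))·n_{ij} = 0. Then there exist τ_c ∈ 𝕊 and, for each m ∈ {0,…,d}, σ_m ∈ 𝕊 and a skew-symmetric c^m : ({0,…,d}\{m}) × ({0,…,d}\{m}) → R, such that for every i ∈ {0,…,d} and every x ∈ T_i: τ_i(x) = μ^{(i)}_c(x)·τ_c + Σ_{m≠i} μ^{(i)}_m(x)·( σ_m + 2·Σ_{j∉{m,i}} c^m_{ij}·sym(t_{m,c} ⊗ t_{m,j}) ). (Characterization Σ^{div}_{1,φ}(T^R;𝕊) = H(div,T;𝕊) ∩ P_1^{-1}(T^R;𝕊): every piecewise-linear symmetric-matrix field on the barycentric split with continuous normal components across all interior faces lies in the explicitly constructed linear element space.) -/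
open Matrix Finset

/-- The bilinear form of `S` evaluated on two members of the family `g`. -/
def familyForm {d : ℕ} {ι : Type*} (g : ι → Fin d → ℝ) (S : Matrix (Fin d) (Fin d) ℝ)
    (a b : ι) : ℝ :=
  g a ⬝ᵥ (S *ᵥ g b)

section familyForm

variable {d : ℕ} {ι : Type*} (g : ι → Fin d → ℝ)

lemma familyForm_add (S S' : Matrix (Fin d) (Fin d) ℝ) (a b : ι) :
    familyForm g (S + S') a b = familyForm g S a b + familyForm g S' a b := by
  simp [familyForm, Matrix.add_mulVec, dotProduct_add]

lemma familyForm_sub (S S' : Matrix (Fin d) (Fin d) ℝ) (a b : ι) :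
    familyForm g (S - S') a b = familyForm g S a b - familyForm g S' a b := by
  simp [familyForm, Matrix.sub_mulVec, dotProduct_sub]

lemma familyForm_smul (r : ℝ) (S : Matrix (Fin d) (Fin d) ℝ) (a b : ι) :
    familyForm g (r • S) a b = r * familyForm g S a b := by
  simp [familyForm, Matrix.smul_mulVec, dotProduct_smul]

lemma familyForm_sum {κ : Type*} (s : Finset κ) (S : κ → Matrix (Fin d) (Fin d) ℝ) (a b : ι) :
    familyForm g (∑ k ∈ s, S k) a b = ∑ k ∈ s, familyForm g (S k) a b := by
  simp [familyForm, Matrix.sum_mulVec, dotProduct_sum]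

lemma familyForm_symOuter (x y : Fin d → ℝ) (a b : ι) :
    familyForm g (symOuter x y) a b
      = (1 / 2) * ((g a ⬝ᵥ x) * (g b ⬝ᵥ y) + (g a ⬝ᵥ y) * (g b ⬝ᵥ x)) := by
  simp [familyForm, symOuter, Matrix.add_mulVec, Matrix.smul_mulVec, dotProduct_add,
    dotProduct_smul, Matrix.vecMulVec_mulVec, dotProduct_comm]
  ring

lemma familyForm_comm {S : Matrix (Fin d) (Fin d) ℝ} (hS : S.IsSymm) (a b : ι) :
    familyForm g S a b = familyForm g S b a := by
  unfold familyForm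
  rw [Matrix.dotProduct_mulVec, ← Matrix.mulVec_transpose, hS.eq, dotProduct_comm]

end familyForm

lemma symOuter_isSymm {d : ℕ} (a b : Fin d → ℝ) : (symOuter a b).IsSymm := by
  ext p q
  simp [symOuter, Matrix.vecMulVec_apply]
  ring

/-- A cocycle of symmetric forms in which each difference `T i - T j` annihilates the
direction `i - j` has differences of the form `p a + p b`. -/
lemma polar_eq_zero_of_difference_annihilates {ι : Type*} (T : ι → ι → ι → ℝ)
    (hsymm : ∀ i a b, T i a b = T i b a)
    (h : ∀ i j b, T i i b - T j i b = T i j b - T j j b) (i j a b : ι) :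
    (T i a a - T j a a) + (T i b b - T j b b) = 2 * (T i a b - T j a b) := by
  let W : ι → ι → ι → ι → ℝ := fun i j k l =>
    (T i j i - T j j i) - (T i k i - T j k i) - (T i j l - T j j l) + (T i k l - T j k l)
  have hW : ∀ i j k l, W i j k l = 0 := by
    have h34 : ∀ i j k l, W i j k l = W i j l k := by
      intro i j k l
      simp only [W]
      linarith [h i j k, h i j l, hsymm i j k, hsymm i j l, hsymm j j k, hsymm j j l,
        hsymm i i k, hsymm i i l, hsymm j i k, hsymm j i l, hsymm i k l, hsymm j k l]
    have h23 : ∀ i j k l, W i j k l = - W i k j l := by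
      intro i j k l
      simp only [W]
      linarith [h i j i, h i j j, h i j k, h i j l, h i k i, h i k j, h i k k, h i k l,
        h j k i, h j k j, h j k k, h j k l,
        hsymm i i j, hsymm i i k, hsymm i j k, hsymm j i j, hsymm j i k, hsymm j j k,
        hsymm k i j, hsymm k i k, hsymm k j k]
    intro i j k l
    linarith [h34 i j k l, h23 i j l k, h34 i l j k, h23 i l k j, h34 i k l j, h23 i k j l]
  have e := hW i j a a
  have e1 := hW i j a b
  have e2 := hW i j b a
  have e3 := hW i j b b
  simp only [W] at e e1 e2 e3
  linarith [hsymm i a b, hsymm j a b]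

/-- Gradients of the barycentric coordinates of a nondegenerate simplex. -/
lemma exists_barycentric_gradients {d : ℕ} (v : Fin (d + 1) → (Fin d → ℝ))
    (hv : AffineIndependent ℝ v) (vc : Fin d → ℝ)
    (hvc : vc = ((d : ℝ) + 1)⁻¹ • ∑ k, v k) :
    ∃ g : Fin (d + 1) → Fin d → ℝ,
      (∀ a b, g a ⬝ᵥ (v b - vc) = (if a = b then 1 else 0) - ((d : ℝ) + 1)⁻¹) ∧
      (∑ a, g a = 0) ∧
      ∀ x, ∑ a, (g a ⬝ᵥ x) • (v a - vc) = x := by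
  have hspan : affineSpan ℝ (Set.range v) = ⊤ := by
    apply hv.affineSpan_eq_top_iff_card_eq_finrank_add_one.mpr
    simp
  let B : AffineBasis (Fin (d + 1)) ℝ (Fin d → ℝ) := ⟨v, hv, hspan⟩
  have hB : ∀ k, B k = v k := fun _ => rfl
  have hd : (d : ℝ) + 1 ≠ 0 := by positivity
  let g : Fin (d + 1) → Fin d → ℝ := fun a p => (B.coord a).linear (Pi.single p 1)
  have hg : ∀ a x, g a ⬝ᵥ x = (B.coord a).linear x := by
    intro a x
    conv_rhs => rw [← Finset.univ_sum_single x, map_sum]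
    refine Finset.sum_congr rfl fun p _ => ?_
    have : (Pi.single p (x p) : Fin d → ℝ) = x p • Pi.single p 1 := by
      rw [← Pi.single_smul]; simp
    rw [this, map_smul]
    simp [g, mul_comm]
  have hgs : ∀ a x y, g a ⬝ᵥ (x - y) = B.coord a x - B.coord a y := by
    intro a x y
    rw [hg]
    exact (B.coord a).linearMap_vsub x y
  have hsum0 : ∑ a, g a = 0 := by
    ext p
    have h1 : ∀ a, g a p = B.coord a (Pi.single p 1) - B.coord a 0 := by
      intro a
      rw [← hgs, sub_zero, dotProduct_single_one]
    simp only [Finset.sum_apply, h1, Finset.sum_sub_distrib, B.sum_coord_apply_eq_one, sub_self,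
      Pi.zero_apply]
  have hbary : ∀ a b, g a ⬝ᵥ (v b - vc) = (if a = b then 1 else 0) - ((d : ℝ) + 1)⁻¹ := by
    intro a b
    have hcoord : ∀ k, B.coord a (v k) = if a = k then 1 else 0 := fun k => by
      rw [← hB]; exact B.coord_apply a k
    have hrew : v b - vc = ((d : ℝ) + 1)⁻¹ • ∑ k, (v b - v k) := by
      rw [hvc, Finset.sum_sub_distrib, smul_sub, Finset.sum_const, Finset.card_univ,
        Fintype.card_fin, ← Nat.cast_smul_eq_nsmul ℝ, smul_smul]
      push_cast
      rw [inv_mul_cancel₀ hd, one_smul]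
    rw [hrew, dotProduct_smul, dotProduct_sum]
    simp only [hgs, hcoord, Finset.sum_sub_distrib, Finset.sum_const, Finset.card_univ,
      Fintype.card_fin, Finset.sum_ite_eq, Finset.mem_univ, if_true, smul_eq_mul, nsmul_eq_mul]
    push_cast
    field_simp
  refine ⟨g, hbary, hsum0, fun x => ?_⟩
  have hx : ∑ a, (g a ⬝ᵥ x) • v a = x := by
    have h1 : ∀ a, g a ⬝ᵥ x = B.coord a x - B.coord a 0 := fun a => by rw [← hgs, sub_zero]
    have h2 := B.linear_combination_coord_eq_self x
    have h3 := B.linear_combination_coord_eq_self (0 : Fin d → ℝ)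
    simp only [hB] at h2 h3
    simp only [h1, sub_smul, Finset.sum_sub_distrib, h2, h3, sub_zero]
  simp only [smul_sub, Finset.sum_sub_distrib, hx, ← Finset.sum_smul, ← sum_dotProduct, hsum0,
    zero_dotProduct, zero_smul, sub_zero]

/-- A matrix vanishes if its form vanishes on a family whose pairings reconstruct vectors. -/
lemma eq_zero_of_familyForm_eq_zero {d : ℕ} {ι : Type*} [Fintype ι] {g e : ι → Fin d → ℝ}
    (hrec : ∀ x, ∑ a, (g a ⬝ᵥ x) • e a = x) {S : Matrix (Fin d) (Fin d) ℝ}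
    (hS : ∀ a b, familyForm g S a b = 0) : S = 0 := by
  have hsep : ∀ x, (∀ a, g a ⬝ᵥ x = 0) → x = 0 := by
    intro x hx
    rw [← hrec x]
    simp [hx]
  have h1 : ∀ b, S *ᵥ g b = 0 := fun b => hsep _ fun a => hS a b
  ext p q
  have h2 : S p = 0 := hsep _ fun a => by
    rw [dotProduct_comm]
    exact congrFun (h1 a) p
  simp [h2]

/-- It suffices to test the form away from one index when the family sums to zero. -/
lemma familyForm_eq_zero_of_ne {d : ℕ} {ι : Type*} [Fintype ι] [DecidableEq ι]
    {g : ι → Fin d → ℝ} (hsum : ∑ a, g a = 0) (m : ι) {S : Matrix (Fin d) (Fin d) ℝ}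
    (hS : ∀ a b, a ≠ m → b ≠ m → familyForm g S a b = 0) (a b : ι) :
    familyForm g S a b = 0 := by
  have hrow : ∀ b, ∑ a, familyForm g S a b = 0 := fun b => by
    simp only [familyForm, ← sum_dotProduct, hsum, zero_dotProduct]
  have hcol : ∀ a, ∑ b, familyForm g S a b = 0 := fun a => by
    simp only [familyForm, ← dotProduct_sum, ← Matrix.mulVec_sum, hsum, Matrix.mulVec_zero,
      dotProduct_zero]
  have h1 : ∀ a b, b ≠ m → familyForm g S a b = 0 := by
    intro a b hb
    by_cases ha : a = m
    · subst ha
      rw [← hrow b]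
      exact (Finset.sum_eq_single a (fun k _ hk => hS k b hk hb) (by simp)).symm
    · exact hS a b ha hb
  by_cases hb : b = m
  · subst hb
    rw [← hcol a]
    exact (Finset.sum_eq_single b (fun k _ hk => h1 a k hk) (by simp)).symm
  · exact h1 a b hb

/-- A vector orthogonal to all `v ℓ - v_c` with `ℓ ≠ i, j` is a multiple of `g i - g j`. -/
lemma eq_smul_gradient_sub {d : ℕ} {g e : Fin (d + 1) → Fin d → ℝ}
    (hge : ∀ a b, g a ⬝ᵥ e b = (if a = b then 1 else 0) - ((d : ℝ) + 1)⁻¹)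
    (hrec : ∀ x, ∑ a, (g a ⬝ᵥ x) • e a = x) (hesum : ∑ a, e a = 0)
    {i j : Fin (d + 1)} (hij : i ≠ j) {w : Fin d → ℝ}
    (hw : ∀ l, l ≠ i → l ≠ j → e l ⬝ᵥ w = 0) :
    w = (e i ⬝ᵥ w) • (g i - g j) := by
  have hj : e j ⬝ᵥ w = - (e i ⬝ᵥ w) := by
    have h0 : ∑ l, e l ⬝ᵥ w = 0 := by rw [← sum_dotProduct, hesum, zero_dotProduct]
    rw [Fintype.sum_eq_add i j hij (fun l hl => hw l hl.1 hl.2)] at h0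
    linarith
  have hz : ∀ l, e l ⬝ᵥ (w - (e i ⬝ᵥ w) • (g i - g j)) = 0 := by
    intro l
    rw [dotProduct_sub, dotProduct_smul, dotProduct_sub, dotProduct_comm (e l) (g i),
      dotProduct_comm (e l) (g j), hge, hge, smul_eq_mul]
    by_cases h1 : l = i
    · subst h1; simp [hij.symm]
    · by_cases h2 : l = j
      · subst h2; simp [hij, hj]; ring
      · simp [hw l h1 h2, Ne.symm h1, Ne.symm h2]
  have hz' : ∀ x : Fin d → ℝ, x ⬝ᵥ (w - (e i ⬝ᵥ w) • (g i - g j)) = 0 := by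
    intro x
    rw [← hrec x, sum_dotProduct]
    simp only [smul_dotProduct, hz, smul_zero, Finset.sum_const_zero]
  exact sub_eq_zero.mp (dotProduct_self_eq_zero.mp (hz' _))

/-- Symmetric matrices at the centre with all normal jumps zero coincide. -/
lemma eq_of_normal_jumps_eq_zero {d : ℕ} {g e : Fin (d + 1) → Fin d → ℝ}
    (hsum : ∑ a, g a = 0) (hrec : ∀ x, ∑ a, (g a ⬝ᵥ x) • e a = x)
    (T : Fin (d + 1) → Matrix (Fin d) (Fin d) ℝ) (hT : ∀ i, (T i).IsSymm)
    (h : ∀ i j, (T i - T j) *ᵥ (g i - g j) = 0) (i j : Fin (d + 1)) : T i = T j := by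
  have key := polar_eq_zero_of_difference_annihilates (fun i => familyForm g (T i))
    (fun i => familyForm_comm g (hT i)) (fun i j b => by
      have := congrArg (fun x => g b ⬝ᵥ x) (h i j)
      simp only [Matrix.mulVec_sub, dotProduct_sub, Matrix.sub_mulVec, dotProduct_zero] at this
      simp only [familyForm_comm g (hT _) _ b]
      simp only [familyForm]
      linarith)
  rw [← sub_eq_zero]
  refine eq_zero_of_familyForm_eq_zero hrec fun a b => ?_
  simp only [← familyForm_sub] at key
  set S := T i - T j with hS
  have hcol : ∀ a, ∑ b, familyForm g S a b = 0 := fun a => by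
    simp only [familyForm, ← dotProduct_sum, ← Matrix.mulVec_sum, hsum, Matrix.mulVec_zero,
      dotProduct_zero]
  have hd : (0 : ℝ) < (d : ℝ) + 1 := by positivity
  have hdiag : ∀ a, ((d : ℝ) + 1) * familyForm g S a a + ∑ b, familyForm g S b b = 0 := by
    intro a
    have h1 := Finset.sum_congr rfl fun b (_ : b ∈ (Finset.univ : Finset (Fin (d + 1)))) =>
      key i j a b
    rw [← Finset.mul_sum, hcol a, Finset.sum_add_distrib, Finset.sum_const, Finset.card_univ,
      Fintype.card_fin, nsmul_eq_mul] at h1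
    push_cast at h1
    linarith
  have htr : ∑ b, familyForm g S b b = 0 := by
    have h1 := Finset.sum_congr rfl fun b (_ : b ∈ (Finset.univ : Finset (Fin (d + 1)))) =>
      hdiag b
    rw [Finset.sum_add_distrib, Finset.sum_const, Finset.card_univ, Fintype.card_fin,
      nsmul_eq_mul, ← Finset.mul_sum] at h1
    push_cast at h1
    simp only [Finset.sum_const_zero] at h1
    nlinarith
  have hzero : ∀ a, familyForm g S a a = 0 := fun a => by
    have := hdiag a
    rw [htr, add_zero] at this
    exact (mul_eq_zero.mp this).resolve_left hd.ne'
  have := key i j a b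
  rw [hzero, hzero] at this
  linarith

/-- Representation of the values at a vertex `v m` of a field with continuous normals. -/
lemma exists_vertex_representation {d : ℕ} (hd : 2 ≤ d) {v : Fin (d + 1) → Fin d → ℝ}
    {vc : Fin d → ℝ} {g : Fin (d + 1) → Fin d → ℝ}
    (hge : ∀ a b, g a ⬝ᵥ (v b - vc) = (if a = b then 1 else 0) - ((d : ℝ) + 1)⁻¹)
    (hsum : ∑ a, g a = 0) (hrec : ∀ x, ∑ a, (g a ⬝ᵥ x) • (v a - vc) = x)
    (m : Fin (d + 1)) (T : Fin (d + 1) → Matrix (Fin d) (Fin d) ℝ) (hT : ∀ i, (T i).IsSymm)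
    (h : ∀ i j, i ≠ m → j ≠ m → (T i - T j) *ᵥ (g i - g j) = 0) :
    ∃ (σ : Matrix (Fin d) (Fin d) ℝ) (c : Fin (d + 1) → Fin (d + 1) → ℝ), σ.IsSymm ∧
      (∀ a b, a ≠ m → b ≠ m → c a b = - c b a) ∧
      ∀ i, i ≠ m → T i = σ + (2 : ℝ) •
        ∑ j ∈ Finset.univ.filter (fun j : Fin (d + 1) => j ≠ m ∧ j ≠ i),
          c i j • symOuter (vc - v m) (v j - v m) := by
  have hjump : ∀ i j b, i ≠ m → j ≠ m → familyForm g (T i) i b - familyForm g (T j) i b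
      = familyForm g (T i) j b - familyForm g (T j) j b := by
    intro i j b hi hj
    have := congrArg (fun x => g b ⬝ᵥ x) (h i j hi hj)
    simp only [Matrix.mulVec_sub, dotProduct_sub, Matrix.sub_mulVec, dotProduct_zero] at this
    simp only [familyForm_comm g (hT _) _ b]
    simp only [familyForm]
    linarith
  have key : ∀ i j a b, i ≠ m → j ≠ m → a ≠ m → b ≠ m →
      (familyForm g (T i) a a - familyForm g (T j) a a)
        + (familyForm g (T i) b b - familyForm g (T j) b b)
      = 2 * (familyForm g (T i) a b - familyForm g (T j) a b) :=
    fun i j a b hi hj ha hb => polar_eq_zero_of_difference_annihilates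
      (ι := {k : Fin (d + 1) // k ≠ m}) (fun i a b => familyForm g (T i) a b)
      (fun i a b => familyForm_comm g (hT i) a b)
      (fun i j b => hjump i j b i.2 j.2) ⟨i, hi⟩ ⟨j, hj⟩ ⟨a, ha⟩ ⟨b, hb⟩
  have hd1 : (d : ℝ) + 1 ≠ 0 := by positivity
  let c : Fin (d + 1) → Fin (d + 1) → ℝ := fun i j =>
    ((d : ℝ) + 1) / 2 * (familyForm g (T i) j j - familyForm g (T j) j j)
  let R : Fin (d + 1) → Matrix (Fin d) (Fin d) ℝ := fun i => (2 : ℝ) •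
    ∑ j ∈ Finset.univ.filter (fun j : Fin (d + 1) => j ≠ m ∧ j ≠ i),
      c i j • symOuter (vc - v m) (v j - v m)
  have hRsymm : ∀ i, (R i).IsSymm := by
    intro i
    refine Matrix.IsSymm.smul ?_ _
    unfold Matrix.IsSymm
    rw [Matrix.transpose_sum]
    exact Finset.sum_congr rfl fun j _ => ((symOuter_isSymm _ _).smul _).eq
  have hcc : ∀ i, c i i = 0 := fun i => by simp [c]
  have hR : ∀ i a b, i ≠ m → a ≠ m → b ≠ m →
      familyForm g (R i) a b = ((d : ℝ) + 1)⁻¹ * (c i a + c i b) := by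
    intro i a b hi ha hb
    have hgc : ∀ a, a ≠ m → g a ⬝ᵥ (vc - v m) = ((d : ℝ) + 1)⁻¹ := fun a ha => by
      rw [← neg_sub, dotProduct_neg, hge, if_neg ha]; ring
    have hgv : ∀ a j, a ≠ m → g a ⬝ᵥ (v j - v m) = if a = j then 1 else 0 := fun a j ha => by
      rw [← sub_sub_sub_cancel_right _ _ vc, dotProduct_sub, hge, hge, if_neg ha]; ring
    simp only [R, familyForm_smul, familyForm_sum, familyForm_symOuter, hgc _ ha, hgc _ hb,
      hgv _ _ ha, hgv _ _ hb]
    rw [Finset.sum_filter]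
    have : ∀ j, (if j ≠ m ∧ j ≠ i then c i j * (1 / 2 * (((d : ℝ) + 1)⁻¹ * (if b = j then 1 else 0)
        + (if a = j then 1 else 0) * ((d : ℝ) + 1)⁻¹)) else 0)
        = (if b = j then 1 / 2 * ((d : ℝ) + 1)⁻¹ * c i j else 0)
          + (if a = j then 1 / 2 * ((d : ℝ) + 1)⁻¹ * c i j else 0) := by
      intro j
      by_cases hjm : j = m
      · subst hjm; simp [ha, hb]
      · by_cases hji : j = i
        · subst hji; simp [hcc]
        · rw [if_pos ⟨hjm, hji⟩]
          split_ifs <;> ring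
    simp only [this, Finset.sum_add_distrib, Finset.sum_ite_eq, Finset.mem_univ, if_true]
    ring
  have : Nontrivial (Fin (d + 1)) := Fin.nontrivial_iff_two_le.mpr (by omega)
  obtain ⟨k, hk⟩ := exists_ne m
  refine ⟨T k - R k, c, (hT k).sub (hRsymm k), ?_, ?_⟩
  · intro a b ha hb
    have h1 := hjump a b a ha hb
    have h2 := hjump a b b ha hb
    have h3 := familyForm_comm g (hT a) a b
    have h4 := familyForm_comm g (hT b) a b
    simp only [c]
    rw [← mul_neg]
    congr 1
    linarith
  · intro i hi
    change T i = T k - R k + R i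
    have hz : T i - R i - (T k - R k) = 0 := by
      refine eq_zero_of_familyForm_eq_zero hrec
        (familyForm_eq_zero_of_ne hsum m fun a b ha hb => ?_)
      simp only [familyForm_sub, hR _ _ _ hi ha hb, hR _ _ _ hk ha hb, c]
      have := key i k a b hi hk ha hb
      field_simp
      linarith
    rw [← sub_eq_zero, ← hz]
    abel


/-- `Σ^{div}_{1,φ}(T^R;𝕊) = H(div,T;𝕊) ∩ P₁⁻¹(T^R;𝕊)`. Every
piecewise-linear symmetric-matrix field `(τ_i)` on the barycentric split with continuous
normal components across all interior faces `F_{ij}` can be written, on each cell `T_i`, as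
`μ^{(i)}_c τ_c + ∑_{m≠i} μ^{(i)}_m (σ_m + 2 ∑_{j∉{m,i}} c^m_{ij} sym(t_{m,c} ⊗ t_{m,j}))`
for some `τ_c, σ_m ∈ 𝕊` and skew-symmetric coefficients `c^m`. -/
theorem statement10 (d : ℕ) (hd : 2 ≤ d)
    (v : Fin (d + 1) → (Fin d → ℝ)) (hv : AffineIndependent ℝ v)
    (vc : Fin d → ℝ) (hvc : vc = ((d : ℝ) + 1)⁻¹ • ∑ k, v k)
    -- barycentric coordinates of the affine bases {v m : m ≠ i} ∪ {v_c}
    (μ : Fin (d + 1) → Fin (d + 1) → (Fin d → ℝ) → ℝ)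
    (μc : Fin (d + 1) → (Fin d → ℝ) → ℝ)
    (hμaff : ∀ i m, ∃ q : (Fin d → ℝ) →ᵃ[ℝ] ℝ, ∀ x, μ i m x = q x)
    (hμcaff : ∀ i, ∃ q : (Fin d → ℝ) →ᵃ[ℝ] ℝ, ∀ x, μc i x = q x)
    (hμself : ∀ i x, μ i i x = 0)
    (hμsum : ∀ i x, μc i x + ∑ m, μ i m x = 1)
    (hμval : ∀ i m m' : Fin (d + 1), m ≠ i → m' ≠ i →
      μ i m (v m') = if m = m' then 1 else 0)
    (hμvc : ∀ i m : Fin (d + 1), m ≠ i → μ i m vc = 0)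
    (hμcval : ∀ i m' : Fin (d + 1), m' ≠ i → μc i (v m') = 0)
    (hμcvc : ∀ i, μc i vc = 1)
    -- a piecewise-affine symmetric-matrix field on the split
    (τ : Fin (d + 1) → (Fin d → ℝ) → Matrix (Fin d) (Fin d) ℝ)
    (hτaff : ∀ i a b, ∃ q : (Fin d → ℝ) →ᵃ[ℝ] ℝ, ∀ x, τ i x a b = q x)
    (hτsymm : ∀ i x, (τ i x).IsSymm)
    -- normal continuity across the interior faces F_{ij}
    (n : Fin (d + 1) → Fin (d + 1) → (Fin d → ℝ))
    (hn0 : ∀ i j : Fin (d + 1), i < j → n i j ≠ 0)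
    (hnorth : ∀ i j : Fin (d + 1), i < j →
      ∀ ℓ, ℓ ≠ i → ℓ ≠ j → (v ℓ - vc) ⬝ᵥ n i j = 0)
    (hjump : ∀ i j : Fin (d + 1), i < j →
      ∀ x ∈ convexHull ℝ ((v '' {ℓ | ℓ ≠ i ∧ ℓ ≠ j}) ∪ {vc}),
        (τ i x - τ j x) *ᵥ n i j = 0) :
    ∃ (τc : Matrix (Fin d) (Fin d) ℝ) (σ : Fin (d + 1) → Matrix (Fin d) (Fin d) ℝ)
      (c : Fin (d + 1) → Fin (d + 1) → Fin (d + 1) → ℝ),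
      τc.IsSymm ∧ (∀ m, (σ m).IsSymm) ∧
      (∀ m a b : Fin (d + 1), a ≠ m → b ≠ m → c m a b = - c m b a) ∧
      ∀ i : Fin (d + 1), ∀ x ∈ convexHull ℝ ((v '' {m | m ≠ i}) ∪ {vc}),
        τ i x = μc i x • τc +
          ∑ m ∈ Finset.univ.filter (fun m : Fin (d + 1) => m ≠ i),
            μ i m x • (σ m + (2 : ℝ) •
              ∑ j ∈ Finset.univ.filter (fun j : Fin (d + 1) => j ≠ m ∧ j ≠ i),
                c m i j • symOuter (vc - v m) (v j - v m)) := by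
  classical
  obtain ⟨g, hge, hgsum, hrec⟩ := exists_barycentric_gradients v hv vc hvc
  have hd1 : (d : ℝ) + 1 ≠ 0 := by positivity
  have hesum : ∑ a, (v a - vc) = 0 := by
    rw [Finset.sum_sub_distrib, Finset.sum_const, Finset.card_univ, Fintype.card_fin, hvc,
      ← Nat.cast_smul_eq_nsmul ℝ, smul_smul]
    push_cast
    rw [mul_inv_cancel₀ hd1, one_smul, sub_self]
  have hjumplt : ∀ i j : Fin (d + 1), i < j →
      ∀ x ∈ (v '' {l | l ≠ i ∧ l ≠ j}) ∪ {vc}, (τ i x - τ j x) *ᵥ (g i - g j) = 0 := by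
    intro i j hij x hx
    have h1 := hjump i j hij x (subset_convexHull ℝ _ hx)
    have h2 := eq_smul_gradient_sub hge hrec hesum hij.ne (hnorth i j hij)
    have h3 : (v i - vc) ⬝ᵥ n i j ≠ 0 := fun h0 => hn0 i j hij (by rw [h2, h0, zero_smul])
    rw [h2, Matrix.mulVec_smul] at h1
    exact (smul_eq_zero.mp h1).resolve_left h3
  have hjumpall : ∀ i j : Fin (d + 1),
      ∀ x ∈ (v '' {l | l ≠ i ∧ l ≠ j}) ∪ {vc}, (τ i x - τ j x) *ᵥ (g i - g j) = 0 := by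
    intro i j x hx
    rcases lt_trichotomy i j with hij | rfl | hij
    · exact hjumplt i j hij x hx
    · simp
    · have := hjumplt j i hij x (by simpa only [and_comm] using hx)
      rw [← neg_sub (τ j x), ← neg_sub (g j), Matrix.neg_mulVec, Matrix.mulVec_neg, neg_neg, this]
  have hcentre := eq_of_normal_jumps_eq_zero hgsum hrec (fun i => τ i vc)
    (fun i => hτsymm i vc) (fun i j => hjumpall i j vc (Or.inr rfl))
  have hvertex := fun m => exists_vertex_representation hd hge hgsum hrec m (fun i => τ i (v m))
    (fun i => hτsymm i (v m)) (fun i j hi hj => hjumpall i j (v m)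
      (Or.inl ⟨m, ⟨hi.symm, hj.symm⟩, rfl⟩))
  choose σ c hσ hc hrep using hvertex
  refine ⟨τ 0 vc, σ, c, hτsymm 0 vc, hσ, hc, fun i x hx => ?_⟩
  have hinterp : τ i x = μc i x • τ i vc +
      ∑ m ∈ Finset.univ.filter (fun m : Fin (d + 1) => m ≠ i), μ i m x • τ i (v m) := by
    ext a b
    obtain ⟨q, hq⟩ := hτaff i a b
    obtain ⟨qc, hqc⟩ := hμcaff i
    choose p hp using hμaff i
    let f : (Fin d → ℝ) →ᵃ[ℝ] ℝ := q - (τ i vc a b • qc +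
      ∑ m ∈ Finset.univ.filter (fun m : Fin (d + 1) => m ≠ i), τ i (v m) a b • p m)
    have hf : ∀ y, f y = τ i y a b - (μc i y • τ i vc + ∑ m ∈ Finset.univ.filter
        (fun m : Fin (d + 1) => m ≠ i), μ i m y • τ i (v m)) a b := by
      intro y
      have hsum : (∑ m ∈ Finset.univ.filter (fun m : Fin (d + 1) => m ≠ i),
          τ i (v m) a b • p m) y = ∑ m ∈ Finset.univ.filter (fun m : Fin (d + 1) => m ≠ i),
          τ i (v m) a b * p m y := by
        induction Finset.univ.filter (fun m : Fin (d + 1) => m ≠ i) using Finset.induction_on with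
        | empty => simp
        | insert k s hk ih => simp [Finset.sum_insert hk, ih]
      simp only [f, AffineMap.coe_sub, AffineMap.coe_add, AffineMap.coe_smul, Pi.sub_apply,
        Pi.add_apply, Pi.smul_apply, hsum]
      simp [Matrix.sum_apply, hq, hqc, hp, mul_comm]
    have hsub : convexHull ℝ ((v '' {m | m ≠ i}) ∪ {vc}) ⊆ f ⁻¹' {0} := by
      refine convexHull_min ?_ ((convex_singleton 0).affine_preimage f)
      rintro y (⟨k, hk, rfl⟩ | rfl)
      · have hs : ∑ m ∈ Finset.univ.filter (fun m : Fin (d + 1) => m ≠ i),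
            μ i m (v k) • τ i (v m) = τ i (v k) := by
          rw [Finset.sum_eq_single k]
          · rw [hμval i k k hk hk, if_pos rfl, one_smul]
          · intro m hm hmk
            rw [hμval i m k (Finset.mem_filter.mp hm).2 hk, if_neg hmk, zero_smul]
          · intro hk'
            exact absurd (Finset.mem_filter.mpr ⟨Finset.mem_univ _, hk⟩) hk'
        rw [Set.mem_preimage, Set.mem_singleton_iff, hf, hs, hμcval i k hk, zero_smul, zero_add,
          sub_self]
      · have hs : ∑ m ∈ Finset.univ.filter (fun m : Fin (d + 1) => m ≠ i),
            μ i m y • τ i (v m) = 0 :=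
          Finset.sum_eq_zero fun m hm => by
            rw [hμvc i m (Finset.mem_filter.mp hm).2, zero_smul]
        rw [Set.mem_preimage, Set.mem_singleton_iff, hf, hs, hμcvc i, one_smul, add_zero,
          sub_self]
    have := hsub hx
    rw [Set.mem_preimage, Set.mem_singleton_iff, hf] at this
    exact sub_eq_zero.mp this
  rw [hinterp, hcentre i 0]
  congr 1
  refine Finset.sum_congr rfl fun m hm => ?_
  rw [← hrep m i (Finset.mem_filter.mp hm).2.symm]
end
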